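/- arXiv:1912.10757 — 4 statements merged into one kernel-verified Lean document; each statement's English description precedes it below -/
import Mathlib

section
/- Let n be a positive natural number, let A be an n×n integer matrix all of whose entries lie in {−1, 1} and which satisfies Aᵀ·A = (n+1)·I_n − J_n, let M be a vector in ℚⁿ, let d ∈ ℚ, and let e_n ∈ ℚⁿ be the all-ones vector. If C = A·M + d·e_n (matrix–vector product over ℚ), then M = (1/(n+1)) · ((I_n + J_n) · Aᵀ) · (C − d·e_n). -/
open Matrix

/-- For the all-ones matrix `J` of order `n`, `(I + J) * ((n + 1) • I - J) = (n + 1) • I`. -/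
lemma one_add_allOnes_mul {n : ℕ} {R : Type*} [CommRing R] :
    ((1 : Matrix (Fin n) (Fin n) R) + Matrix.of fun _ _ => (1 : R))
      * (((n : R) + 1) • 1 - Matrix.of fun _ _ => (1 : R)) = ((n : R) + 1) • 1 := by
  have hJJ : (Matrix.of fun _ _ => (1 : R) : Matrix (Fin n) (Fin n) R)
      * (Matrix.of fun _ _ => (1 : R)) = (n : R) • Matrix.of fun _ _ => (1 : R) := by
    ext i j
    simp [Matrix.mul_apply]
  rw [add_mul, mul_sub, mul_sub, hJJ, one_mul, one_mul, mul_smul_comm, mul_one]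
  module

/-- Exact (non-modular) decryption identity. If `A` is a conference
matrix (entries in {-1,1}, `Aᵀ * A = (n+1) • I - J`), `M : ℚⁿ`, `d : ℚ`, `e` the
all-ones vector, and `C = A *ᵥ M + d • e`, then
`M = (1/(n+1)) • (((I + J) * Aᵀ) *ᵥ (C - d • e))`. -/
theorem statement3 (n : ℕ) (hn : 0 < n) (A : Matrix (Fin n) (Fin n) ℤ)
    (hentries : ∀ i j, A i j = -1 ∨ A i j = 1)
    (J : Matrix (Fin n) (Fin n) ℤ) (hJ : ∀ i j, J i j = 1)
    (hconf : Aᵀ * A = (n + 1) • (1 : Matrix (Fin n) (Fin n) ℤ) - J)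
    (M C : Fin n → ℚ) (d : ℚ) (e : Fin n → ℚ) (he : ∀ i, e i = 1)
    (hC : C = (A.map ((↑) : ℤ → ℚ)) *ᵥ M + d • e) :
    M = (1 / ((n : ℚ) + 1)) •
          ((((1 : Matrix (Fin n) (Fin n) ℚ) + Matrix.of fun _ _ => (1 : ℚ))
              * (A.map ((↑) : ℤ → ℚ))ᵀ) *ᵥ (C - d • e)) := by
  have hA : (A.map ((↑) : ℤ → ℚ))ᵀ * A.map ((↑) : ℤ → ℚ)
      = ((n : ℚ) + 1) • 1 - Matrix.of fun _ _ => (1 : ℚ) := by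
    ext i j
    have h := congrArg (Int.cast : ℤ → ℚ) (congrFun (congrFun hconf i) j)
    obtain rfl | hij := eq_or_ne i j
    · simpa [Matrix.mul_apply, hJ, Matrix.natCast_apply] using h
    · simpa [Matrix.mul_apply, hJ, Matrix.natCast_apply, hij] using h
  have hn1 : (n : ℚ) + 1 ≠ 0 := by positivity
  rw [hC, add_sub_cancel_right, mulVec_mulVec, Matrix.mul_assoc, hA, one_add_allOnes_mul,
    smul_mulVec, one_mulVec, smul_smul, one_div_mul_cancel hn1, one_smul]
end

section
/- (Paper's Theorem) Let n and q be positive natural numbers with gcd(n+1, q) = 1, and let A be an n×n integer matrix all of whose entries lie in {−1, 1} and which satisfies Aᵀ·A = (n+1)·I_n − J_n. Let t ∈ ℤ/qℤ satisfy (n+1)·t = 1 in ℤ/qℤ. Let M be any vector in (ℤ/qℤ)ⁿ, let d ∈ ℤ/qℤ, let e_n be the all-ones vector, and set C = Ā·M + d·e_n, where Ā is the reduction of A modulo q. Then the decrypted vector D = t · ((I_n + J_n) · Āᵀ) · (C − d·e_n) (all operations in ℤ/qℤ) satisfies D = M; that is, the ciphertext decrypts uniquely to the original message. -/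
open Matrix

/-- Paper's Theorem: Let `gcd (n+1) q = 1`, `A` a conference matrix
(entries in {-1,1}, `Aᵀ * A = (n+1) • I - J` over ℤ), and `t : ZMod q` with
`(n+1) * t = 1`. For any message `M : (ZMod q)ⁿ`, constant `d`, all-ones vector
`e`, ciphertext `C = Ā *ᵥ M + d • e` (with `Ā` the mod-`q` reduction of `A`),
the decrypted vector `D = t • (((I + J) * Āᵀ) *ᵥ (C - d • e))` equals `M`. -/
theorem statement4 (n q : ℕ) (hn : 0 < n) (hq : 0 < q)
    (hcop : Nat.Coprime (n + 1) q)
    (A : Matrix (Fin n) (Fin n) ℤ)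
    (hentries : ∀ i j, A i j = -1 ∨ A i j = 1)
    (J : Matrix (Fin n) (Fin n) ℤ) (hJ : ∀ i j, J i j = 1)
    (hconf : Aᵀ * A = (n + 1) • (1 : Matrix (Fin n) (Fin n) ℤ) - J)
    (t : ZMod q) (ht : ((n : ZMod q) + 1) * t = 1)
    (M : Fin n → ZMod q) (d : ZMod q) (e : Fin n → ZMod q) (he : ∀ i, e i = 1)
    (C D : Fin n → ZMod q)
    (hC : C = (A.map ((↑) : ℤ → ZMod q)) *ᵥ M + d • e)
    (hD : D = t • ((((1 : Matrix (Fin n) (Fin n) (ZMod q))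
            + Matrix.of fun _ _ => (1 : ZMod q))
          * (A.map ((↑) : ℤ → ZMod q))ᵀ) *ᵥ (C - d • e))) :
    D = M := by
  set B : Matrix (Fin n) (Fin n) (ZMod q) := A.map ((↑) : ℤ → ZMod q) with hB
  have hAJ : Bᵀ * B = ((n : ZMod q) + 1) • (1 : Matrix (Fin n) (Fin n) (ZMod q))
      - Matrix.of fun _ _ => (1 : ZMod q) := by
    ext i j
    have h := congrArg (Int.cast : ℤ → ZMod q) (congrFun (congrFun hconf i) j)
    simp only [mul_apply, transpose_apply, Matrix.sub_apply, Matrix.smul_apply, hJ] at h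
    simp only [hB, mul_apply, transpose_apply, map_apply, Matrix.sub_apply, Matrix.smul_apply, of_apply,
      smul_eq_mul]
    by_cases hij : i = j <;> simpa [Matrix.one_apply, hij] using h
  have hJJ : (Matrix.of fun _ _ => (1 : ZMod q)) * (Matrix.of fun _ _ => (1 : ZMod q))
      = (n : ZMod q) • (Matrix.of fun _ _ => (1 : ZMod q) : Matrix (Fin n) (Fin n) (ZMod q)) := by
    ext i j
    simp [mul_apply]
  have key : (((1 : Matrix (Fin n) (Fin n) (ZMod q)) + Matrix.of fun _ _ => (1 : ZMod q)) * Bᵀ) * B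
      = ((n : ZMod q) + 1) • (1 : Matrix (Fin n) (Fin n) (ZMod q)) := by
    rw [Matrix.mul_assoc, hAJ, add_mul, mul_sub, mul_sub, hJJ, one_mul, one_mul, mul_smul_comm, mul_one]
    module
  rw [hD, hC, add_sub_cancel_right, mulVec_mulVec, key, smul_mulVec, one_mulVec, smul_smul,
    mul_comm t, ht, one_smul]
end

section
/- Let n and q be positive natural numbers with gcd(n+1, q) = 1, let A be an n×n integer matrix all of whose entries lie in {−1, 1} and which satisfies Aᵀ·A = (n+1)·I_n − J_n, and let d ∈ ℤ/qℤ. Then the encryption map on (ℤ/qℤ)ⁿ sending M to Ā·M + d·e_n (where Ā is the reduction of A modulo q and e_n is the all-ones vector) is injective; in particular, distinct plaintext blocks always produce distinct ciphertext blocks. -/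
open Matrix

/-- If `B * A` is the scalar matrix `k` over `ℤ` and `k` is coprime to `q`, then multiplication
by the reduction of `A` modulo `q` is injective. -/
theorem Matrix.mulVec_map_intCast_injective_of_mul_eq_smul_one {m n : Type*} [Fintype m]
    [Fintype n] [DecidableEq n] {k q : ℕ} (hkq : Nat.Coprime k q)
    {A : Matrix m n ℤ} {B : Matrix n m ℤ} (h : B * A = k • (1 : Matrix n n ℤ)) :
    Function.Injective (A.map ((↑) : ℤ → ZMod q)).mulVec := by
  have hmod : B.map (Int.castRingHom (ZMod q)) * A.map (Int.castRingHom (ZMod q)) =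
      (k : ZMod q) • (1 : Matrix n n (ZMod q)) := by
    rw [← Matrix.map_mul, h]
    ext i j
    rw [map_apply, smul_apply, smul_apply, map_nsmul, nsmul_eq_mul, smul_eq_mul, one_apply,
      one_apply]
    split_ifs <;> simp
  have hk : IsUnit (k : ZMod q) := (ZMod.isUnit_iff_coprime k q).2 hkq
  intro x y hxy
  have hB := congrArg ((B.map (Int.castRingHom (ZMod q))) *ᵥ ·) hxy
  change _ *ᵥ (A.map (Int.castRingHom (ZMod q)) *ᵥ x) =
    _ *ᵥ (A.map (Int.castRingHom (ZMod q)) *ᵥ y) at hB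
  simp only [mulVec_mulVec, hmod, smul_mulVec, one_mulVec] at hB
  exact hk.smul_left_cancel.1 hB

/-- The matrix `(n + 1) • 1 - J`, with `J` the all-ones matrix, has `1 + J` as a left inverse up to
the factor `n + 1`. -/
theorem Matrix.one_add_mul_smul_one_sub_of_forall_eq_one {n : ℕ} {J : Matrix (Fin n) (Fin n) ℤ}
    (hJ : ∀ i j, J i j = 1) :
    (1 + J) * ((n + 1) • (1 : Matrix (Fin n) (Fin n) ℤ) - J) = (n + 1) • 1 := by
  have hJJ : J * J = n • J := by
    ext i j
    simp [Matrix.mul_apply, hJ]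
  rw [mul_sub, add_mul, add_mul, hJJ, one_mul, one_mul, mul_smul_comm, mul_one, add_smul n 1 J,
    one_smul]
  abel

/-- Under `gcd (n+1) q = 1` and `A` a conference matrix (entries in
{-1,1}, `Aᵀ * A = (n+1) • I - J` over ℤ), the encryption map
`M ↦ Ā *ᵥ M + d • e` on `(ZMod q)ⁿ` is injective. -/
theorem statement5 (n q : ℕ) (hn : 0 < n) (hq : 0 < q)
    (hcop : Nat.Coprime (n + 1) q)
    (A : Matrix (Fin n) (Fin n) ℤ)
    (hentries : ∀ i j, A i j = -1 ∨ A i j = 1)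
    (J : Matrix (Fin n) (Fin n) ℤ) (hJ : ∀ i j, J i j = 1)
    (hconf : Aᵀ * A = (n + 1) • (1 : Matrix (Fin n) (Fin n) ℤ) - J)
    (d : ZMod q) (e : Fin n → ZMod q) (he : ∀ i, e i = 1) :
    Function.Injective
      (fun M : Fin n → ZMod q => (A.map ((↑) : ℤ → ZMod q)) *ᵥ M + d • e) := by
  have h : (1 + J) * Aᵀ * A = (n + 1) • (1 : Matrix (Fin n) (Fin n) ℤ) := by
    rw [Matrix.mul_assoc, hconf, Matrix.one_add_mul_smul_one_sub_of_forall_eq_one hJ]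
  exact (add_left_injective (d • e)).comp
    (Matrix.mulVec_map_intCast_injective_of_mul_eq_smul_one hcop h)
end

section
/- (Paley-type construction, conference identity) Let F be a finite field with n = card(F) ≡ 3 (mod 4), and define the n×n integer matrix A, indexed by F × F, by A(i,j) = −1 if i = j and A(i,j) = χ(j − i) otherwise, where χ is the quadratic character of F. Then Aᵀ·A = (n+1)·I − J and A·Aᵀ = (n+1)·I − J, where I is the identity matrix and J the all-ones matrix indexed by F; that is, A is a conference matrix of order n in the sense of this paper. -/
open Matrix

lemma quadraticChar_sum_sub_mul_sub {F : Type*} [Field F] [Fintype F] [DecidableEq F]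
    (hF : ringChar F ≠ 2) (a b : F) :
    ∑ x, quadraticChar F (x - a) * quadraticChar F (x - b) =
      if a = b then (Fintype.card F : ℤ) - 1 else -1 := by
  split_ifs with hab
  · subst hab
    have hterm (x : F) : quadraticChar F x * quadraticChar F x = 1 - if x = 0 then 1 else 0 := by
      split_ifs with hx
      · simp [hx]
      · rw [← sq, quadraticChar_sq_one hx, sub_zero]
    simp only [hterm, sub_eq_zero]
    simp
  · have hba : b - a ≠ 0 := sub_ne_zero.mpr (Ne.symm hab)
    have hJ := jacobiSum_nontrivial_inv (quadraticChar_ne_one hF)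
    rw [(quadraticChar_isQuadratic F).inv, jacobiSum] at hJ
    rw [← ((Equiv.mulLeft₀ (b - a) hba).trans (Equiv.addRight a)).sum_comp]
    have hneg : quadraticChar F (-1) * quadraticChar F (-1) = 1 := by
      rw [← map_mul, neg_mul_neg, one_mul, map_one]
    have hterm (x : F) :
        quadraticChar F ((b - a) * x + a - a) * quadraticChar F ((b - a) * x + a - b) =
          quadraticChar F (-1) * (quadraticChar F x * quadraticChar F (1 - x)) := by
      rw [show (b - a) * x + a - a = (b - a) * x by ring,
        show (b - a) * x + a - b = (b - a) * (-1 * (1 - x)) by ring]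
      simp only [map_mul]
      linear_combination quadraticChar F x * quadraticChar F (-1) * quadraticChar F (1 - x) *
        quadraticChar_sq_one hba
    simp only [Equiv.trans_apply, Equiv.mulLeft₀_apply, Equiv.coe_addRight, hterm]
    rw [← Finset.mul_sum, hJ, mul_neg, hneg]

/-- Paley-type construction, conference identity: For a finite
field `F` with `n = card F ≡ 3 [MOD 4]`, the matrix
`A i j = if i = j then -1 else χ (j - i)` satisfies
`Aᵀ * A = (n+1) • I - J` and `A * Aᵀ = (n+1) • I - J`. -/
theorem statement7 (F : Type*) [Field F] [Fintype F] [DecidableEq F]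
    (hF : Fintype.card F % 4 = 3)
    (A : Matrix F F ℤ)
    (hA : ∀ i j, A i j = if i = j then -1 else quadraticChar F (j - i))
    (J : Matrix F F ℤ) (hJ : ∀ i j, J i j = 1) :
    Aᵀ * A = (Fintype.card F + 1) • (1 : Matrix F F ℤ) - J ∧
      A * Aᵀ = (Fintype.card F + 1) • (1 : Matrix F F ℤ) - J := by
  have hchar : ringChar F ≠ 2 := fun h ↦ by
    have := FiniteField.even_card_of_char_two h
    lia
  have hneg : quadraticChar F (-1) = -1 :=
    quadraticChar_neg_one_iff_not_isSquare.mpr fun h ↦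
      FiniteField.isSquare_neg_one_iff.mp h hF
  obtain ⟨C, hCχ⟩ : ∃ C : Matrix F F ℤ, ∀ i j, C i j = quadraticChar F (j - i) :=
    ⟨.of fun i j ↦ quadraticChar F (j - i), fun _ _ ↦ rfl⟩
  have hAC : A = C - 1 := by
    ext i j
    rw [hA, Matrix.sub_apply, one_apply, hCχ]
    split_ifs with hij <;> simp [hij]
  have hC : Cᵀ = -C := by
    ext i j
    rw [transpose_apply, Matrix.neg_apply, hCχ, hCχ, ← neg_sub, neg_eq_neg_one_mul, map_mul,
      hneg, neg_one_mul]
  have hCC : C * Cᵀ = Fintype.card F • (1 : Matrix F F ℤ) - J := by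
    ext i j
    simp only [mul_apply, transpose_apply, hCχ, quadraticChar_sum_sub_mul_sub hchar,
      Matrix.sub_apply, Matrix.smul_apply, one_apply, hJ]
    split_ifs <;> simp
  have hsq : 1 - C * C = (Fintype.card F + 1) • (1 : Matrix F F ℤ) - J := by
    rw [hC, mul_neg] at hCC
    rw [sub_eq_add_neg, hCC, add_smul, one_smul]
    abel
  rw [← hsq, hAC, transpose_sub, transpose_one, hC]
  constructor <;> noncomm_ring
end
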